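/- arXiv:2310.06986 — 2 statements merged into one kernel-verified Lean document; each statement's English description precedes it below -/
import Mathlib

section
/- For integers i ≥ 2, j ≥ 1 set v^I_{ij} = ṽ^I_{ij} + ṽ^II_{ij} and v^II_{ij} = ṽ^I_{ij} − ṽ^II_{ij} (the H(curl) interior shape functions on the triangle). With α₁(k,l) = (1/8)(2k−1)(2l+2k−1)(l+2k−1) and α₂(k,l) = (1/16)(2k−1)(2l+2k−1), define for k ≥ 2, l ≥ 1 the dual functions b^I_{kl} = ½( α₁(k,l) B_{kl} + α₂(k,l) C_{kl} ) and b^II_{kl} = ½( α₁(k,l) B_{kl} − α₂(k,l) C_{kl} ). Then for all integers i, k ≥ 2, j, l ≥ 1 and all types T₁, T₂ ∈ {I, II}: ∫_△ v^{T₁}_{ij}(x,y) · b^{T₂}_{kl}(x,y) dx dy = 1 if (i, j, T₁) = (k, l, T₂), and = 0 otherwise. -/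
open MeasureTheory

/-- Jacobi polynomial `P_n^{(a,b)}` via the Rodrigues formula (on `(-1,1)`). -/
noncomputable def jacobiP (n a b : ℕ) (x : ℝ) : ℝ :=
  (1 / ((2:ℝ)^n * (Nat.factorial n : ℝ) * (1 - x)^a * (1 + x)^b)) *
    iteratedDeriv n (fun t : ℝ => (1 - t)^a * (1 + t)^b * (t^2 - 1)^n) x

/-- Legendre polynomial `L_n = P_n^{(0,0)}`. -/
noncomputable def legendreP (n : ℕ) (x : ℝ) : ℝ := jacobiP n 0 0 x

/-- Integrated Jacobi polynomial `P̂_n^a(x) = ∫_{-1}^x P_{n-1}^{(a,0)}(t) dt`. -/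
noncomputable def intJacobiP (n a : ℕ) (x : ℝ) : ℝ :=
  ∫ t in (-1:ℝ)..x, jacobiP (n - 1) a 0 t

/-- Integrated Legendre polynomial `L̂_n`. -/
noncomputable def intLegendreP (n : ℕ) (x : ℝ) : ℝ := intJacobiP n 0 x

/-- The open reference triangle with vertices `(-1,-1)`, `(1,-1)`, `(0,1)`. -/
def Tri : Set (ℝ × ℝ) := {p | -1 < p.2 ∧ p.2 < 1 ∧ |p.1| < (1 - p.2) / 2}

/-- Euclidean dot product in `ℝ²`. -/
def dot2 (p q : ℝ × ℝ) : ℝ := p.1 * q.1 + p.2 * q.2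

/-- Auxiliary `H(curl)` interior field `ṽ^I_{ij} = (∇f_i) g_{ij}` on the triangle. -/
noncomputable def vtTriI (i j : ℕ) (p : ℝ × ℝ) : ℝ × ℝ :=
  (legendreP (i-1) (2*p.1 / (1 - p.2)) * ((1 - p.2)/2)^(i-1) * intJacobiP j (2*i) p.2,
   (1/2) * legendreP (i-2) (2*p.1 / (1 - p.2)) * ((1 - p.2)/2)^(i-1) * intJacobiP j (2*i) p.2)

/-- Auxiliary `H(curl)` interior field `ṽ^II_{ij} = f_i ∇g_{ij}` on the triangle. -/
noncomputable def vtTriII (i j : ℕ) (p : ℝ × ℝ) : ℝ × ℝ :=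
  (0, intLegendreP i (2*p.1 / (1 - p.2)) * ((1 - p.2)/2)^i * jacobiP (j-1) (2*i) 0 p.2)

/-- First dual candidate `B_{kl}` on the triangle. -/
noncomputable def Btri (k l : ℕ) (p : ℝ × ℝ) : ℝ × ℝ :=
  (legendreP (k-1) (2*p.1 / (1 - p.2)) * ((1 - p.2)/2)^(k-1) * jacobiP (l-1) (2*k-1) 1 p.2, 0)

/-- Second dual candidate `C_{kl}` on the triangle. -/
noncomputable def Ctri (k l : ℕ) (p : ℝ × ℝ) : ℝ × ℝ :=
  (((k:ℝ) + 1) * jacobiP (k-1) 1 1 (2*p.1 / (1 - p.2)) * ((1 - p.2)/2)^(k-1) *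
     jacobiP (l-1) (2*k) 0 p.2,
   -2*(k:ℝ) * jacobiP (k-2) 1 1 (2*p.1 / (1 - p.2)) * ((1 - p.2)/2)^(k-1) *
     jacobiP (l-1) (2*k) 0 p.2)

/-- `H(curl)` interior shape function of type I on the triangle. -/
noncomputable def vTriI (i j : ℕ) (p : ℝ × ℝ) : ℝ × ℝ := vtTriI i j p + vtTriII i j p

/-- `H(curl)` interior shape function of type II on the triangle. -/
noncomputable def vTriII (i j : ℕ) (p : ℝ × ℝ) : ℝ × ℝ := vtTriI i j p - vtTriII i j p

/-- The coefficient `α₁(k,l) = (1/8)(2k-1)(2l+2k-1)(l+2k-1)`. -/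
noncomputable def alphaTri1 (k l : ℕ) : ℝ :=
  (1/8) * (2*(k:ℝ) - 1) * (2*(l:ℝ) + 2*(k:ℝ) - 1) * ((l:ℝ) + 2*(k:ℝ) - 1)

/-- The coefficient `α₂(k,l) = (1/16)(2k-1)(2l+2k-1)`. -/
noncomputable def alphaTri2 (k l : ℕ) : ℝ :=
  (1/16) * (2*(k:ℝ) - 1) * (2*(l:ℝ) + 2*(k:ℝ) - 1)

/-- Dual function of type I on the triangle. -/
noncomputable def bTriI (k l : ℕ) (p : ℝ × ℝ) : ℝ × ℝ :=
  ((1/2) : ℝ) • (alphaTri1 k l • Btri k l p + alphaTri2 k l • Ctri k l p)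

/-- Dual function of type II on the triangle. -/
noncomputable def bTriII (k l : ℕ) (p : ℝ × ℝ) : ℝ × ℝ :=
  ((1/2) : ℝ) • (alphaTri1 k l • Btri k l p - alphaTri2 k l • Ctri k l p)


section Helpers
open Polynomial in
noncomputable def wP (a b : ℕ) : ℝ[X] := (X - C 1)^a * (X + C 1)^b

open Polynomial in
noncomputable def II (p : ℝ[X]) : ℝ := ∫ x in (-1:ℝ)..1, p.eval x

open Polynomial

lemma II_int (p : ℝ[X]) (a b : ℝ) : IntervalIntegrable (fun x => p.eval x) volume a b :=
  (p.continuous).intervalIntegrable a b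

lemma II_add (p q : ℝ[X]) : II (p+q) = II p + II q := by
  simp only [II, eval_add]
  exact intervalIntegral.integral_add (II_int _ _ _) (II_int _ _ _)

lemma II_sub (p q : ℝ[X]) : II (p-q) = II p - II q := by
  simp only [II, eval_sub]
  exact intervalIntegral.integral_sub (II_int _ _ _) (II_int _ _ _)

lemma II_C (c : ℝ) (p : ℝ[X]) : II (C c * p) = c * II p := by
  simp only [II, eval_mul, eval_C]
  exact intervalIntegral.integral_const_mul _ _

lemma int_deriv (p : ℝ[X]) (a b : ℝ) : ∫ x in a..b, (derivative p).eval x = p.eval b - p.eval a :=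
  intervalIntegral.integral_eq_sub_of_hasDerivAt (fun x _ => p.hasDerivAt x) (II_int _ _ _)

lemma II_deriv (p : ℝ[X]) : II (derivative p) = p.eval 1 - p.eval (-1) := int_deriv p _ _

lemma wP_monic (a b : ℕ) : (wP a b).Monic := 
  ((monic_X_sub_C _).pow _).mul ((monic_X_add_C _).pow _)

lemma wP_deg (a b : ℕ) : (wP a b).natDegree = a + b := by
  rw [wP, Monic.natDegree_mul ((monic_X_sub_C _).pow _) ((monic_X_add_C _).pow _),
   (monic_X_sub_C _).natDegree_pow,  (monic_X_add_C _).natDegree_pow]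
  rw [natDegree_X_sub_C, natDegree_X_add_C]; simp

lemma wP_succ (a b n : ℕ) : wP (a+n) (b+n) = wP a b * wP n n := by
  simp only [wP]; ring

lemma parts (f : ℝ[X]) : ∀ (n : ℕ) (_ : ∀ m < n, (derivative^[m] f).eval 1 = 0)
    (_ : ∀ m < n, (derivative^[m] f).eval (-1) = 0) (q : ℝ[X]),
    II (derivative^[n] f * q) = (-1)^n * II (f * derivative^[n] q) := by
  intro n
  induction n with
  | zero => intro _ _ q; simp
  | succ n ih =>
    intro h1 h2 q
    have e : derivative^[n+1] f * q = derivative (derivative^[n] f * q) - derivative^[n] f * derivative q := by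
      rw [derivative_mul, Function.iterate_succ_apply']; ring
    rw [e, II_sub, II_deriv, ih (fun m hm => h1 m (by omega)) (fun m hm => h2 m (by omega)),
      eval_mul, eval_mul, h1 n (by omega), h2 n (by omega), Function.iterate_succ_apply]
    ring

lemma wP_dvd1 (a b n m : ℕ) (h : a + m ≤ n) : (X - C 1)^a ∣ derivative^[m] (wP n b) := by
  refine (pow_dvd_pow _ (by omega : a ≤ n - m)).trans ?_
  exact pow_sub_dvd_iterate_derivative_of_pow_dvd m (Dvd.intro _ rfl)

lemma wP_dvd2 (a b n m : ℕ) (h : b + m ≤ n) : (X + C 1)^b ∣ derivative^[m] (wP a n) := by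
  refine (pow_dvd_pow _ (by omega : b ≤ n - m)).trans ?_
  exact pow_sub_dvd_iterate_derivative_of_pow_dvd m (Dvd.intro_left _ rfl)

lemma wP_ev1 (a b m : ℕ) (h : m < a) : (derivative^[m] (wP a b)).eval 1 = 0 := by
  have := wP_dvd1 1 b a m (by omega)
  rw [pow_one] at this
  exact dvd_iff_isRoot.1 this

lemma wP_ev2 (a b m : ℕ) (h : m < b) : (derivative^[m] (wP a b)).eval (-1) = 0 := by
  have := wP_dvd2 a 1 b m (by omega)
  rw [pow_one] at this
  obtain ⟨c, hc⟩ := this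
  rw [hc]; simp

lemma exJ (n a b : ℕ) : ∃ J : ℝ[X], wP a b * J =
    C (1 / (2^n * (n.factorial:ℝ))) * derivative^[n] (wP (a+n) (b+n)) := by
  have : wP a b ∣ derivative^[n] (wP (a+n) (b+n)) := by
    refine IsCoprime.mul_dvd ?_ (wP_dvd1 _ _ _ _ le_rfl) (wP_dvd2 _ _ _ _ le_rfl)
    refine IsCoprime.pow ⟨-C (1/2), C (1/2), ?_⟩
    ext1 
    simp only [coeff_add]
    have : -C (1/2:ℝ) * (X - C 1) + C (1/2) * (X + C 1) = C (1/2 + 1/2) := by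
      rw [C_add]; simp only [C_1]; ring
    rw [← coeff_add, this]; norm_num
  obtain ⟨J, hJ⟩ := this
  exact ⟨C (1 / (2^n * (n.factorial:ℝ))) * J, by rw [hJ]; ring⟩

noncomputable def JP (n a b : ℕ) : ℝ[X] := (exJ n a b).choose

lemma JP_spec (n a b : ℕ) : wP a b * JP n a b =
    C (1 / (2^n * (n.factorial:ℝ))) * derivative^[n] (wP (a+n) (b+n)) := (exJ n a b).choose_spec

lemma jacobi_eq (n a b : ℕ) (x : ℝ) (h1 : -1 < x) (h2 : x < 1) :
    jacobiP n a b x = (JP n a b).eval x := by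
  have e : (fun t : ℝ => (1 - t)^a * (1 + t)^b * (t^2 - 1)^n) =
     fun t => (C ((-1)^a) * wP (a+n) (b+n)).eval t := by
    ext t
    simp only [wP, eval_mul, eval_pow, eval_C, eval_sub, eval_X, eval_add]
    rw [show t^2-1 = (t-1)*(t+1) by ring, show 1 - t = (-1)*(t-1) by ring, mul_pow, mul_pow, pow_add, pow_add]
    ring
  have h := congrArg (fun p => eval x p) (JP_spec n a b)
  simp only [wP, eval_mul, eval_pow, eval_C, eval_sub, eval_X, eval_add] at h
  have d := iterate_derivative_C_mul ((-1:ℝ)^a) (wP (a+n) (b+n)) n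
  rw [jacobiP, e]
  have : ∀ (p : ℝ[X]), iteratedDeriv n (fun t => p.eval t) = fun t => (derivative^[n] p).eval t := by
    intro p
    clear e h d
    induction n with
    | zero => simp
    | succ n ih =>
      rw [iteratedDeriv_succ, Function.iterate_succ_apply', ih]; ext t; exact Polynomial.deriv _
  rw [this, d]
  simp only [wP, eval_mul, eval_C] at h ⊢
  have p1 : (x - 1)^a ≠ 0 := pow_ne_zero _ (by linarith)
  have p2 : (x + 1)^b ≠ 0 := pow_ne_zero _ (by linarith)
  have p3 : (2:ℝ)^n * (n.factorial:ℝ) ≠ 0 := by positivity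
  rw [show 1 - x = (-1)*(x-1) by ring, mul_pow, add_comm 1 x]
  have p4 : ((-1:ℝ))^a ≠ 0 := pow_ne_zero _ (by norm_num)
  field_simp
  field_simp at h
  linarith

lemma beta (p : ℕ) : ∀ q, II (wP p q) = (-1)^p * 2^(p+q+1) * p.factorial * q.factorial / (p+q+1).factorial := by
  induction p with
  | zero =>
    intro q
    have : wP 0 q = derivative (C (1/((q:ℝ)+1)) * (X + C 1)^(q+1)) := by
      rw [derivative_C_mul, derivative_pow]
      simp only [wP, derivative_add, derivative_X, derivative_C, pow_zero, one_mul, add_zero, mul_one, add_tsub_cancel_right]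
      rw [← mul_assoc, ← C_mul]
      have : 1/((q:ℝ)+1) * ((q+1:ℕ):ℝ) = 1 := by push_cast; field_simp
      rw [this]; simp
    rw [this, II_deriv]
    simp only [eval_mul, eval_C, eval_pow, eval_add, eval_X]
    rw [zero_add, Nat.factorial_succ]
    push_cast
    have : ((q.factorial:ℕ):ℝ) ≠ 0 := by positivity
    field_simp
    norm_num
  | succ p ih =>
    intro q
    have : C ((q:ℝ)+1) * wP (p+1) q = derivative (wP (p+1) (q+1)) - C ((p:ℝ)+1) * wP p (q+1) := by
      simp only [wP, derivative_mul, derivative_pow, derivative_sub, derivative_add, derivative_X, derivative_C, add_tsub_cancel_right]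
      push_cast
      simp only [C_add, C_1, map_natCast]
      ring
    have h := congrArg II this
    rw [II_C, II_sub, II_deriv, II_C, ih] at h
    have e1 : eval 1 (wP (p+1) (q+1)) = 0 := by simp [wP]
    have e2 : eval (-1) (wP (p+1) (q+1)) = 0 := by simp [wP]
    rw [e1, e2] at h
    have hq : (q:ℝ)+1 ≠ 0 := by positivity
    apply mul_left_cancel₀ hq
    rw [h, show p + 1 + q + 1 = p + (q+1) + 1 by ring, Nat.factorial_succ q, Nat.factorial_succ p]
    push_cast
    ring

lemma JP_deg (n a b : ℕ) : (JP n a b).natDegree ≤ n ∧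
    (JP n a b).coeff n = (2*n+a+b).factorial / (2^n * n.factorial * (n+a+b).factorial) := by
  have h := JP_spec n a b
  have d : (JP n a b).natDegree ≤ n := by
    by_cases h0 : JP n a b = 0
    · simp [h0]
    · have := congrArg natDegree h
      rw [(wP_monic a b).natDegree_mul' h0, wP_deg] at this
      have h3 := natDegree_C_mul_le (1 / (2^n * (n.factorial:ℝ))) (derivative^[n] (wP (a+n) (b+n)))
      have h4 := natDegree_iterate_derivative (wP (a+n) (b+n)) n
      rw [wP_deg] at h4
      omega
  refine ⟨d, ?_⟩
  have : coeff _ ((a+b)+n) = coeff _ ((a+b)+n) := congrArg (fun p => coeff p ((a+b)+n)) h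
  rw [coeff_mul_add_eq_of_natDegree_le (wP_deg a b).le d, coeff_C_mul, coeff_iterate_derivative] at this
  have m1 := (wP_monic a b).coeff_natDegree
  have m2 := (wP_monic (a+n) (b+n)).coeff_natDegree
  rw [wP_deg] at m1 m2
  rw [m1, show a+b+n+n = a+n+(b+n) by ring, m2, one_mul] at this
  rw [this, nsmul_eq_mul, mul_one]
  have f := Nat.factorial_mul_descFactorial (show n ≤ a+n+(b+n) by omega)
  rw [show a+n+(b+n)-n = n+a+b by omega] at f
  rw [show 2*n+a+b = a+n+(b+n) by ring, ← f]
  push_cast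
  have : ((n+a+b).factorial : ℝ) ≠ 0 := by positivity
  field_simp

lemma rodr (n a b : ℕ) (q : ℝ[X]) : II (wP a b * JP n a b * q) =
   (1 / (2^n * (n.factorial:ℝ))) * ((-1)^n * II (wP (a+n) (b+n) * derivative^[n] q)) := by
  rw [JP_spec, mul_assoc, II_C, parts]
  · intro m hm; exact wP_ev1 _ _ _ (by omega)
  · intro m hm; exact wP_ev2 _ _ _ (by omega)

lemma orth (n a b : ℕ) (q : ℝ[X]) (h : q.natDegree < n) : II (wP a b * JP n a b * q) = 0 := by
  rw [rodr, iterate_derivative_eq_zero h]; simp [II]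

lemma orth2 (n m a b : ℕ) (h : n ≠ m) : II (wP a b * JP n a b * JP m a b) = 0 := by
  rcases lt_or_gt_of_ne h with h | h
  · rw [mul_right_comm]
    exact orth _ _ _ _ ((JP_deg n a b).1.trans_lt h)
  · exact orth _ _ _ _ ((JP_deg m a b).1.trans_lt h)

lemma norm_J (n a b : ℕ) : II (wP a b * JP n a b * JP n a b) =
   (-1)^a * 2^(a+b+1) * (a+n).factorial * (b+n).factorial /
     (n.factorial * (n+a+b).factorial * (2*n+a+b+1)) := by
  have : derivative^[n] (JP n a b) = C (n.factorial * (JP n a b).coeff n) := by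
    ext m
    rw [coeff_iterate_derivative, coeff_C]
    split_ifs with h
    · subst h; simp [Nat.descFactorial_self]
    · rw [coeff_eq_zero_of_natDegree_lt]
      · simp
      · have := (JP_deg n a b).1; omega
  rw [rodr, this, mul_comm (wP _ _), II_C, beta, (JP_deg n a b).2]
  rw [show a+n+(b+n)+1 = (2*n+a+b)+1 by ring, Nat.factorial_succ]
  have h1 : ((n+a+b).factorial : ℝ) ≠ 0 := by positivity
  have h2 : ((2*n+a+b).factorial : ℝ) ≠ 0 := by positivity
  have h3 : ((n).factorial : ℝ) ≠ 0 := by positivity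
  have h4 : (2*n+a+b+1 : ℝ) ≠ 0 := by positivity
  have h5 : (-1:ℝ)^n * (-1)^n = 1 := by rw [← mul_pow]; simp
  push_cast
  rw [pow_add (-1:ℝ)]
  field_simp
  rw [show (2:ℝ)^(2*n+a+b+1) = (2^n)^2*2^(a+b+1) by ring]
  linear_combination (2^(a+b+1) * (2^n)^2 : ℝ) * h5

lemma uniq (n a b : ℕ) (q : ℝ[X]) (c : ℝ) (hd : q.natDegree ≤ n)
    (ho : ∀ p : ℝ[X], (∀ m, n ≤ m → p.coeff m = 0) → II (wP a b * q * p) = 0)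
    (hc : q.coeff n = c * (JP n a b).coeff n) : q = C c * JP n a b := by
  set r := q - C c * JP n a b with hr
  have hrd : ∀ m, n ≤ m → r.coeff m = 0 := by
    intro m hm
    rw [hr, coeff_sub, coeff_C_mul]
    rcases hm.eq_or_lt with h | h
    · subst h; rw [hc]; ring
    · rw [coeff_eq_zero_of_natDegree_lt (hd.trans_lt h),
        coeff_eq_zero_of_natDegree_lt ((JP_deg n a b).1.trans_lt h)]; ring
  have h1 := ho r hrd
  have h2 : II (wP a b * JP n a b * r) = 0 := by
    by_cases h0 : r = 0
    · rw [h0]; simp [II]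
    · apply orth
      by_contra h
      push Not at h
      exact h0 (leadingCoeff_eq_zero.1 (hrd _ h))
  have h3 : II (wP a b * r * r) = 0 := by
    have : wP a b * r * r = wP a b * q * r - C c * (wP a b * JP n a b * r) := by
      nth_rewrite 1 [hr]; ring
    rw [this, II_sub, II_C, h1, h2]; ring
  have h4 : ∫ x in (-1:ℝ)..1, (1-x)^a*(1+x)^b * (r.eval x)^2 = 0 := by
    have : ∀ x : ℝ, (1-x)^a*(1+x)^b * (r.eval x)^2 = (C ((-1)^a) * (wP a b * r * r)).eval x := by
      intro x
      simp only [wP, eval_mul, eval_pow, eval_C, eval_sub, eval_X, eval_add]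
      rw [show 1 - x = (-1)*(x-1) by ring, mul_pow, add_comm 1 x]; ring
    simp_rw [this]
    have := II_C ((-1)^a) (wP a b * r * r)
    rw [h3, mul_zero] at this
    exact this
  have h5 : r = 0 := by
    by_contra h0
    refine h0 (eq_zero_of_infinite_isRoot r ?_)
    have : Set.Ioo (-1:ℝ) 1 ⊆ {x | r.IsRoot x} := by
      intro x hx
      by_contra hne
      have hpos : 0 < ∫ x in (-1:ℝ)..1, (1-x)^a*(1+x)^b * (r.eval x)^2 := by
        apply intervalIntegral.integral_pos (by norm_num) (by fun_prop)
        · intro y hy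
          have : 0 ≤ 1 - y := by linarith [hy.2]
          have : 0 ≤ 1 + y := by linarith [hy.1]
          positivity
        · refine ⟨x, ⟨hx.1.le, hx.2.le⟩, ?_⟩
          have : 0 < 1 - x := by linarith [hx.2]
          have : 0 < 1 + x := by linarith [hx.1]
          have : r.eval x ≠ 0 := hne
          positivity
      linarith
    exact (Set.Ioo_infinite (by norm_num)).mono this
  exact sub_eq_zero.1 h5

lemma nat_lt_of (n : ℕ) (p : ℝ[X]) (h : ∀ m, n ≤ m → p.coeff m = 0) : p = 0 ∨ p.natDegree < n := by
  by_cases h0 : p = 0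
  · exact Or.inl h0
  · right
    by_contra hh
    push Not at hh
    exact h0 (leadingCoeff_eq_zero.1 (h _ hh))

lemma orth' (n a b : ℕ) (q : ℝ[X]) (h : ∀ m, n ≤ m → q.coeff m = 0) :
    II (wP a b * JP n a b * q) = 0 := by
  rcases nat_lt_of n q h with h | h
  · rw [h]; simp [II]
  · exact orth _ _ _ _ h

lemma JP_coeff_zero (n a b m : ℕ) (h : n < m) : (JP n a b).coeff m = 0 :=
  coeff_eq_zero_of_natDegree_lt ((JP_deg n a b).1.trans_lt h)

lemma id1 (n a : ℕ) : derivative ((X + C 1) * JP n a 1) = C ((n:ℝ)+1) * JP n (a+1) 0 := by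
  apply uniq
  · refine (natDegree_derivative_le _).trans ?_
    have h1 := natDegree_mul_le (p := (X + C 1 : ℝ[X])) (q := JP n a 1)
    have h2 := (JP_deg n a 1).1
    rw [natDegree_X_add_C] at h1
    omega
  · intro p hp
    have e : wP (a+1) 0 * derivative ((X + C 1) * JP n a 1) * p =
       derivative ((X + C 1) * JP n a 1 * ((X - C 1)^(a+1) * p)) -
        wP a 1 * JP n a 1 * (C ((a:ℝ)+1) * p + X * derivative p - derivative p) := by
      simp only [wP, derivative_mul, derivative_pow, derivative_sub, derivative_add, derivative_X, derivative_C, add_tsub_cancel_right]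
      push_cast
      simp only [C_add, C_1, map_natCast]
      ring
    rw [e, II_sub, II_deriv, orth']
    · simp
    · intro m hm
      rw [coeff_sub, coeff_add, coeff_C_mul, hp m hm, coeff_derivative, hp (m+1) (by omega)]
      cases m with
      | zero => simp
      | succ m => rw [coeff_X_mul, coeff_derivative, hp (m+1) hm]; simp
  · rw [coeff_derivative, add_mul, coeff_add, coeff_X_mul, coeff_C_mul, JP_coeff_zero n a 1 (n+1) (by omega),
      (JP_deg n a 1).2, (JP_deg n (a+1) 0).2]
    rw [show 2*n+(a+1)+0 = 2*n+a+1 by ring, show n+(a+1)+0 = n+a+1 by ring]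
    ring

lemma id2 (n : ℕ) : derivative (wP 1 1 * JP n 1 1) = C (2*((n:ℝ)+1)) * JP (n+1) 0 0 := by
  have h := JP_spec (n+1) 0 0
  rw [show wP 0 0 = 1 by simp [wP], one_mul, Function.iterate_succ_apply'] at h
  rw [JP_spec, h, derivative_C_mul, ← mul_assoc, ← C_mul]
  rw [show 0 + (n+1) = 1 + n by ring]
  congr 2
  rw [Nat.factorial_succ]
  push_cast
  have h3 : ((n).factorial : ℝ) ≠ 0 := by positivity
  field_simp
  ring

lemma id3 (n : ℕ) : derivative (JP (n+1) 0 0) = C (((n:ℝ)+2)/2) * JP n 1 1 := by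
  apply uniq
  · refine (natDegree_derivative_le _).trans ?_
    have h2 := (JP_deg (n+1) 0 0).1
    omega
  · intro p hp
    have e : wP 1 1 * derivative (JP (n+1) 0 0) * p =
       derivative (wP 1 1 * JP (n+1) 0 0 * p) -
        wP 0 0 * JP (n+1) 0 0 * (derivative (X^2 * p - p)) := by
      simp only [wP, derivative_mul, derivative_pow, derivative_sub, derivative_add, derivative_X, derivative_C, add_tsub_cancel_right]
      push_cast
      simp only [C_1, map_natCast]
      ring_nf
      simp [C_ofNat]
      try ring
    rw [e, II_sub, II_deriv, orth']
    · simp [wP]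
    · intro m hm
      obtain ⟨m, rfl⟩ : ∃ m', m = m' + 1 := ⟨m-1, by omega⟩
      rw [coeff_derivative, coeff_sub, show m + 1 + 1 = m + 2 by ring, coeff_X_pow_mul, hp m (by omega), hp (m+2) (by omega)]
      simp
  · rw [coeff_derivative, (JP_deg n 1 1).2, (JP_deg (n+1) 0 0).2]
    rw [show 2*(n+1)+0+0 = 2*n+1+1 by ring, show n+1+0+0 = n+1 by ring, Nat.factorial_succ (n+1), Nat.factorial_succ n]
    push_cast
    have h3 : ((n).factorial : ℝ) ≠ 0 := by positivity
    field_simp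
    ring

lemma ev_gen (n : ℕ) (r : ℝ) (g : ℝ[X]) : (derivative^[n] ((X - C r)^n * g)).eval r = n.factorial * g.eval r := by
  rw [← factorial_smul_hasseDeriv, LinearMap.smul_apply, eval_smul, nsmul_eq_mul]
  rw [← taylor_coeff, taylor_mul, taylor_pow]
  rw [show taylor r (X - C r) = X by simp, coeff_X_pow_mul', if_pos le_rfl, Nat.sub_self, taylor_coeff_zero]

lemma JP_one (n : ℕ) : (JP n 0 0).eval 1 = 1 := by
  have h := JP_spec n 0 0
  rw [show wP 0 0 = 1 by simp [wP], one_mul, zero_add] at h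
  rw [h, eval_mul, eval_C, wP, ev_gen]
  simp only [eval_pow, eval_add, eval_X, eval_C]
  have h3 : ((n).factorial : ℝ) ≠ 0 := by positivity
  norm_num
  field_simp

lemma JP_neg_one (n : ℕ) : (JP n 0 0).eval (-1) = (-1)^n := by
  have h := JP_spec n 0 0
  rw [show wP 0 0 = 1 by simp [wP], one_mul, zero_add] at h
  rw [h, eval_mul, eval_C, wP, mul_comm, show (X + C 1 : ℝ[X]) = X - C (-1) by simp, mul_comm, mul_comm ((X - C 1)^n), ev_gen]
  simp only [eval_pow, eval_sub, eval_X, eval_C]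
  have h3 : ((n).factorial : ℝ) ≠ 0 := by positivity
  rw [show (-1 - 1 : ℝ) = (-1)*2 by norm_num, mul_pow]
  field_simp

lemma F_ge (m k : ℕ) (h : k ≤ m) : II (JP m 0 0 * derivative (JP k 0 0)) = 0 := by
  have := orth' m 0 0 (derivative (JP k 0 0)) (fun t ht => by
    rw [coeff_derivative, JP_coeff_zero _ _ _ _ (by omega), zero_mul])
  rwa [show wP 0 0 = 1 by simp [wP], one_mul] at this

lemma F_lt (m k : ℕ) (h : m < k) : II (JP m 0 0 * derivative (JP k 0 0)) = 1 - (-1)^(m+k) := by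
  have e : JP m 0 0 * derivative (JP k 0 0) =
    derivative (JP m 0 0 * JP k 0 0) - JP k 0 0 * derivative (JP m 0 0) := by
    rw [derivative_mul]; ring
  rw [e, II_sub, II_deriv, F_ge _ _ h.le, eval_mul, eval_mul, JP_one, JP_one, JP_neg_one, JP_neg_one]
  ring

lemma Z (m n : ℕ) : II (C ((n:ℝ)+3) * (JP (m+1) 0 0 * JP (n+1) 1 1)
    - C ((n:ℝ)+2) * (JP m 0 0 * JP n 1 1)) = 0 := by
  have e : C ((n:ℝ)+3) * (JP (m+1) 0 0 * JP (n+1) 1 1)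
    - C ((n:ℝ)+2) * (JP m 0 0 * JP n 1 1) = C 2 * (JP (m+1) 0 0 * derivative (JP (n+2) 0 0)
      - JP m 0 0 * derivative (JP (n+1) 0 0)) := by
    rw [id3, id3]
    have h1 : C ((n:ℝ)+3) = C 2 * C ((((n+1:ℕ):ℝ)+2)/2) := by rw [← C_mul]; congr 1; push_cast; ring
    have h2 : C ((n:ℝ)+2) = C 2 * C ((((n:ℝ)+2)/2)) := by rw [← C_mul]; congr 1; ring
    rw [h1, h2]; ring
  rw [e, II_C, II_sub]
  rcases lt_or_ge m (n+1) with h | h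
  · rw [F_lt _ _ h, F_lt _ _ (by omega)]; ring
  · rw [F_ge _ _ h, F_ge _ _ (by omega)]; ring

lemma intJ_gen (j a : ℕ) (Q : ℝ[X]) (hQ : derivative Q = JP j a 0) (h0 : Q.eval (-1) = 0)
   (y : ℝ) (h1 : -1 < y) (h2 : y < 1) :
    intJacobiP (j+1) a y = Q.eval y := by
  rw [intJacobiP]
  have : ∫ t in (-1:ℝ)..y, jacobiP (j+1-1) a 0 t = ∫ t in (-1:ℝ)..y, (derivative Q).eval t := by
    apply intervalIntegral.integral_congr_ae
    filter_upwards with t ht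
    rw [Set.uIoc_of_le h1.le] at ht
    rw [hQ]
    exact jacobi_eq _ _ _ _ ht.1 (ht.2.trans_lt h2)
  rw [this, int_deriv, h0, sub_zero]

lemma intJ (j a : ℕ) (y : ℝ) (h1 : -1 < y) (h2 : y < 1) :
    intJacobiP (j+1) (a+1) y = (C (1/((j:ℝ)+1)) * ((X + C 1) * JP j a 1)).eval y := by
  apply intJ_gen _ _ _ _ _ _ h1 h2
  · rw [derivative_C_mul, id1, ← mul_assoc, ← C_mul]
    have : (1/((j:ℝ)+1))*((j:ℝ)+1) = 1 := by field_simp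
    rw [this]; simp
  · simp

lemma intL (n : ℕ) (y : ℝ) (h1 : -1 < y) (h2 : y < 1) :
    intLegendreP (n+2) y = (C (1/(2*((n:ℝ)+1))) * (wP 1 1 * JP n 1 1)).eval y := by
  apply intJ_gen _ _ _ _ _ _ h1 h2
  · rw [derivative_C_mul, id2, ← mul_assoc, ← C_mul]
    have : (1/(2*((n:ℝ)+1)))*(2*((n:ℝ)+1)) = 1 := by field_simp
    rw [this]; simp
  · simp [wP]

noncomputable def SP : ℝ[X] := C (-1/2) * (X - C 1)

lemma SP_eval (y : ℝ) : SP.eval y = (1-y)/2 := by simp [SP]; ring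

lemma tri_open : IsOpen Tri := by
  have : Tri = {p : ℝ × ℝ | -1 < p.2} ∩ ({p | p.2 < 1} ∩ {p | |p.1| < (1-p.2)/2}) := rfl
  rw [this]
  exact (isOpen_lt (by fun_prop) (by fun_prop)).inter ((isOpen_lt (by fun_prop) (by fun_prop)).inter
    (isOpen_lt (by fun_prop) (by fun_prop)))

lemma tri_eta (p : ℝ × ℝ) (hp : p ∈ Tri) : -1 < 2*p.1/(1-p.2) ∧ 2*p.1/(1-p.2) < 1 := by
  obtain ⟨h1, h2, h3⟩ := hp
  rw [abs_lt] at h3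
  have : 0 < 1 - p.2 := by linarith
  rw [lt_div_iff₀ this, div_lt_iff₀ this]
  constructor <;> linarith [h3.1, h3.2]

lemma tri_int1 (A G : ℝ[X]) : IntegrableOn (fun p : ℝ × ℝ => A.eval (2*p.1/(1-p.2)) * G.eval p.2) Tri := by
  have hsub : Tri ⊆ Set.Icc (-1:ℝ) 1 ×ˢ Set.Icc (-1:ℝ) 1 := by
    rintro p ⟨h1, h2, h3⟩
    rw [abs_lt] at h3
    refine ⟨⟨?_, ?_⟩, ⟨h1.le, h2.le⟩⟩ <;> linarith [h3.1, h3.2]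
  have hfin : volume Tri < ⊤ := 
    (measure_mono hsub).trans_lt (isCompact_Icc.prod isCompact_Icc).measure_lt_top
  obtain ⟨c1, hc1⟩ := (isCompact_Icc (a := (-1:ℝ)) (b := 1)).exists_bound_of_continuousOn A.continuous.continuousOn
  obtain ⟨c2, hc2⟩ := (isCompact_Icc (a := (-1:ℝ)) (b := 1)).exists_bound_of_continuousOn G.continuous.continuousOn
  refine IntegrableOn.of_bound hfin ?_ (c1*c2) ?_
  · apply ContinuousOn.aestronglyMeasurable _ tri_open.measurableSet
    have : ContinuousOn (fun p : ℝ × ℝ => 2*p.1/(1-p.2)) Tri := by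
      apply ContinuousOn.div (by fun_prop) (by fun_prop)
      rintro p ⟨h1, h2, h3⟩
      linarith
    exact (A.continuous.comp_continuousOn this).mul (by fun_prop)
  · refine (ae_restrict_iff' tri_open.measurableSet).2 (Filter.Eventually.of_forall ?_)
    intro p hp
    have h := tri_eta p hp
    rw [norm_mul]
    have a1 := hc1 _ ⟨h.1.le, h.2.le⟩
    have a2 := hc2 p.2 ⟨hp.1.le, hp.2.1.le⟩
    exact mul_le_mul a1 a2 (norm_nonneg _) ((norm_nonneg _).trans a1)

lemma tri_int2 (A G : ℝ[X]) : ∫ p in Tri, A.eval (2*p.1/(1-p.2)) * G.eval p.2 = II A * II (SP * G) := by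
  rw [← integral_indicator tri_open.measurableSet, Measure.volume_eq_prod, integral_prod_symm]
  swap
  · rw [← Measure.volume_eq_prod]
    exact (integrable_indicator_iff tri_open.measurableSet).2 (tri_int1 A G)
  have key : ∀ y : ℝ, ∫ x : ℝ, Tri.indicator (fun p : ℝ × ℝ => A.eval (2*p.1/(1-p.2)) * G.eval p.2) (x, y)
     = (Set.Ioo (-1:ℝ) 1).indicator (fun y => II A * (SP * G).eval y) y := by
    intro y
    by_cases hy : y ∈ Set.Ioo (-1:ℝ) 1
    · rw [Set.indicator_of_mem hy]
      have hs : 0 < (1-y)/2 := by linarith [hy.2]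
      have : ∀ x : ℝ, Tri.indicator (fun p : ℝ × ℝ => A.eval (2*p.1/(1-p.2)) * G.eval p.2) (x, y) =
         (Set.Ioo (-((1-y)/2)) ((1-y)/2)).indicator (fun x => A.eval (x / ((1-y)/2)) * G.eval y) x := by
        intro x
        by_cases hx : x ∈ Set.Ioo (-((1-y)/2)) ((1-y)/2)
        · rw [Set.indicator_of_mem hx, Set.indicator_of_mem]
          · simp only
            congr 2
            have : 1 - y ≠ 0 := by linarith
            field_simp
          · exact ⟨hy.1, hy.2, abs_lt.2 hx⟩
        · rw [Set.indicator_of_notMem hx, Set.indicator_of_notMem]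
          rintro ⟨_, _, h⟩
          exact hx (abs_lt.1 h)
      simp_rw [this]
      rw [integral_indicator measurableSet_Ioo, ← integral_Ioc_eq_integral_Ioo,
        ← intervalIntegral.integral_of_le (by linarith), intervalIntegral.integral_mul_const,
        intervalIntegral.integral_comp_div (fun x => A.eval x) hs.ne', neg_div, div_self hs.ne', eval_mul, SP_eval, II, smul_eq_mul]
      ring
    · rw [Set.indicator_of_notMem hy]
      have : ∀ x : ℝ, Tri.indicator (fun p : ℝ × ℝ => A.eval (2*p.1/(1-p.2)) * G.eval p.2) (x, y) = 0 := by
        intro x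
        apply Set.indicator_of_notMem
        rintro ⟨h1, h2, _⟩
        exact hy ⟨h1, h2⟩
      simp [this]
  simp_rw [key]
  rw [integral_indicator measurableSet_Ioo, integral_const_mul, ← integral_Ioc_eq_integral_Ioo,
        ← intervalIntegral.integral_of_le (by norm_num)]
  rfl

noncomputable def A1 (m n : ℕ) : ℝ[X] := JP (m+1) 0 0 * JP (n+1) 0 0
noncomputable def PH (j m : ℕ) : ℝ[X] := C (1/((j:ℝ)+1)) * ((X + C 1) * JP j (2*m+3) 1)
noncomputable def G1 (m j n l : ℕ) : ℝ[X] := SP^(m+1) * SP^(n+1) * PH j m * JP l (2*n+3) 1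
noncomputable def A2 (m n : ℕ) : ℝ[X] := C ((n:ℝ)+3) * (JP (m+1) 0 0 * JP (n+1) 1 1)
    - C ((n:ℝ)+2) * (JP m 0 0 * JP n 1 1)
noncomputable def G2 (m j n l : ℕ) : ℝ[X] := SP^(m+1) * SP^(n+1) * PH j m * JP l (2*n+4) 0
noncomputable def A3 (m n : ℕ) : ℝ[X] :=
  C (-2*((n:ℝ)+2)) * (C (1/(2*((m:ℝ)+1))) * (wP 1 1 * JP m 1 1) * JP n 1 1)
noncomputable def G3 (m j n l : ℕ) : ℝ[X] := SP^(m+2) * SP^(n+1) * JP j (2*m+4) 0 * JP l (2*n+4) 0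

lemma V1 (m j n l : ℕ) : alphaTri1 (n+2) (l+1) * (II (A1 m n) * II (SP * G1 m j n l)) =
    if (m+2, j+1) = (n+2, l+1) then 1 else 0 := by
  by_cases hm : m = n
  · subst hm
    have e : SP * G1 m j m l = C ((-1/2)^(2*m+3) * (1/((j:ℝ)+1))) *
        (wP (2*m+3) 1 * JP j (2*m+3) 1 * JP l (2*m+3) 1) := by
      rw [G1, PH, wP, SP, C_mul, C_pow]
      generalize (C (-1/2) : ℝ[X]) = c
      generalize (X - C 1 : ℝ[X]) = u
      simp only [mul_pow]
      ring
    rw [e, II_C]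
    by_cases hj : j = l
    · subst hj
      have e2 : A1 m m = wP 0 0 * JP (m+1) 0 0 * JP (m+1) 0 0 := by simp [A1, wP]
      rw [norm_J, e2, norm_J, if_pos rfl, alphaTri1]
      rw [show 1 + j = j + 1 by ring, show 2*m+3+j = j + (2*m+3) by ring,
        Nat.factorial_succ j, Nat.factorial_succ (j + (2*m+3)),
        show 0 + (m+1) = m+1 by ring, show m+1+0+0 = m+1 by ring]
      have f1 : ((j).factorial : ℝ) ≠ 0 := by positivity
      have f2 : ((m+1).factorial : ℝ) ≠ 0 := by positivity
      have f3 : ((j+(2*m+3)).factorial : ℝ) ≠ 0 := by positivity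
      have f4 : (-1/2 : ℝ)^(2*m+3) * (-1)^(2*m+3) * 2^(2*m+3) = 1 := by
        rw [← mul_pow, ← mul_pow]; norm_num
      push_cast
      rw [show 2*m+3+1+1 = (2*m+3) + 2 by ring, pow_add (2:ℝ) (2*m+3)]
      generalize (-1/2 : ℝ)^(2*m+3) = u at *
      generalize (-1 : ℝ)^(2*m+3) = v at *
      generalize (2 : ℝ)^(2*m+3) = w at *
      have g1 : (2*((m:ℝ)+2) - 1) = 2*m+3 := by ring
      have g2 : (2*((j:ℝ)+1) + 2*((m:ℝ)+2) - 1) = 2*j+2*m+5 := by ring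
      have g3 : (((j:ℝ)+1) + 2*((m:ℝ)+2) - 1) = j+2*m+4 := by ring
      have g4 : (2*((m:ℝ)+1)+0+0+1) = 2*m+3 := by ring
      have g5 : (2*(j:ℝ)+(2*m+3)+1+1) = 2*j+2*m+5 := by ring
      have g6 : ((j:ℝ)+(2*m+3)+1) = j+2*m+4 := by ring
      have p1 : (2*(m:ℝ)+3) ≠ 0 := by positivity
      have p2 : (2*(j:ℝ)+2*m+5) ≠ 0 := by positivity
      have p3 : ((j:ℝ)+2*m+4) ≠ 0 := by positivity
      have p4 : ((j:ℝ)+1) ≠ 0 := by positivity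
      rw [g1, g2, g3, g4, g5, g6]
      field_simp
      linear_combination 8 * f4
    · rw [orth2 _ _ _ _ hj, if_neg]
      · ring
      · simp [hj]
  · have : II (A1 m n) = 0 := by
      have := orth2 (m+1) (n+1) 0 0 (by omega)
      rwa [show wP 0 0 = 1 by simp [wP], one_mul] at this
    rw [this, if_neg]
    · ring
    · simp [hm]

lemma V2 (m n : ℕ) : II (A2 m n) = 0 := Z m n

lemma V3 (m j n l : ℕ) : alphaTri2 (n+2) (l+1) * (II (A3 m n) * II (SP * G3 m j n l)) =
    if (m+2, j+1) = (n+2, l+1) then 1 else 0 := by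
  have eA : A3 m n = C (-2*((n:ℝ)+2) * (1/(2*((m:ℝ)+1)))) * (wP 1 1 * JP m 1 1 * JP n 1 1) := by
    rw [A3, C_mul (a := -2*((n:ℝ)+2))]; simp only [mul_assoc]
  rw [eA, II_C]
  by_cases hm : m = n
  · subst hm
    have e : SP * G3 m j m l = C ((-1/2)^(2*m+4)) *
        (wP (2*m+4) 0 * JP j (2*m+4) 0 * JP l (2*m+4) 0) := by
      rw [G3, wP, SP, C_pow]
      generalize (C (-1/2) : ℝ[X]) = c
      generalize (X - C 1 : ℝ[X]) = u
      simp only [mul_pow]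
      ring
    rw [e, II_C]
    by_cases hj : j = l
    · subst hj
      rw [norm_J, norm_J, if_pos rfl, alphaTri2]
      rw [show 0 + j = j by ring, show 2*m+4+j = j + (2*m+4) by ring, 
        show j + (2*m+4) + 0 = j + (2*m+4) by ring,
        show 1 + m = m+1 by ring, Nat.factorial_succ (m+1), Nat.factorial_succ m]
      have f1 : ((j).factorial : ℝ) ≠ 0 := by positivity
      have f2 : ((m).factorial : ℝ) ≠ 0 := by positivity
      have f3 : ((j+(2*m+4)).factorial : ℝ) ≠ 0 := by positivity
      have f4 : (-1/2 : ℝ)^(2*m+4) * (-1)^(2*m+4) * 2^(2*m+4) = 1 := by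
        rw [← mul_pow, ← mul_pow]; norm_num
      push_cast
      rw [show 2*m+4+0+1 = (2*m+4) + 1 by ring, pow_add (2:ℝ) (2*m+4)]
      generalize (-1/2 : ℝ)^(2*m+4) = u at *
      generalize (-1 : ℝ)^(2*m+4) = v at *
      generalize (2 : ℝ)^(2*m+4) = w at *
      have g1 : (2*((m:ℝ)+2) - 1) = 2*m+3 := by ring
      have g2 : (2*((j:ℝ)+1) + 2*((m:ℝ)+2) - 1) = 2*j+2*m+5 := by ring
      have g4 : (2*(m:ℝ)+1+1+1) = 2*m+3 := by ring
      have g5 : (2*(j:ℝ)+(2*m+4)+0+1) = 2*j+2*m+5 := by ring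
      have g6 : ((m:ℝ)+1+1) = m+2 := by ring
      have p1 : (2*(m:ℝ)+3) ≠ 0 := by positivity
      have p2 : (2*(j:ℝ)+2*m+5) ≠ 0 := by positivity
      have p3 : ((m:ℝ)+2) ≠ 0 := by positivity
      have p4 : ((m:ℝ)+1) ≠ 0 := by positivity
      rw [g1, g2, g4, g5, g6]
      field_simp
      linear_combination 16 * f4
    · rw [orth2 _ _ _ _ hj, if_neg]
      · ring
      · simp [hj]
  · rw [orth2 _ _ _ _ hm, if_neg]
    · ring
    · simp [hm]


lemma pt1 (m j n l : ℕ) (p : ℝ × ℝ) (hp : p ∈ Tri) : dot2 (vtTriI (m+2) (j+1) p) (Btri (n+2) (l+1) p) =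
    (A1 m n).eval (2*p.1/(1-p.2)) * (G1 m j n l).eval p.2 := by
  have h := tri_eta p hp
  have y1 := hp.1
  have y2 := hp.2.1
  have e1 : 2*(m+2) = (2*m+3)+1 := by ring
  have e2 : 2*(n+2)-1 = 2*n+3 := by omega
  simp only [dot2, vtTriI, Btri, legendreP, e1, e2, intJ _ _ _ y1 y2, jacobi_eq _ _ _ _ h.1 h.2,
    jacobi_eq _ _ _ _ y1 y2, A1, G1, PH, eval_mul, eval_pow, SP_eval]
  rw [show m+2-1 = m+1 by omega, show n+2-1 = n+1 by omega, show l+1-1 = l by omega]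
  ring

lemma pt2 (m j n l : ℕ) (p : ℝ × ℝ) (hp : p ∈ Tri) : dot2 (vtTriI (m+2) (j+1) p) (Ctri (n+2) (l+1) p) =
    (A2 m n).eval (2*p.1/(1-p.2)) * (G2 m j n l).eval p.2 := by
  have h := tri_eta p hp
  have y1 := hp.1
  have y2 := hp.2.1
  have e1 : 2*(m+2) = (2*m+3)+1 := by ring
  have e2 : 2*(n+2) = 2*n+4 := by omega
  simp only [dot2, vtTriI, Ctri, legendreP, e1, e2, intJ _ _ _ y1 y2, jacobi_eq _ _ _ _ h.1 h.2,
    jacobi_eq _ _ _ _ y1 y2, A2, G2, PH, eval_mul, eval_pow, SP_eval, eval_sub, eval_C]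
  rw [show m+2-1 = m+1 by omega, show n+2-1 = n+1 by omega, show l+1-1 = l by omega,
    show m+2-2 = m by omega, show n+2-2 = n by omega]
  push_cast
  ring

lemma pt3 (m j n l : ℕ) (p : ℝ × ℝ) (hp : p ∈ Tri) : dot2 (vtTriII (m+2) (j+1) p) (Ctri (n+2) (l+1) p) =
    (A3 m n).eval (2*p.1/(1-p.2)) * (G3 m j n l).eval p.2 := by
  have h := tri_eta p hp
  have y1 := hp.1
  have y2 := hp.2.1
  have e1 : 2*(m+2) = 2*m+4 := by ring
  have e2 : 2*(n+2) = 2*n+4 := by omega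
  simp only [dot2, vtTriII, Ctri, e1, e2, intL _ _ h.1 h.2, jacobi_eq _ _ _ _ h.1 h.2,
    jacobi_eq _ _ _ _ y1 y2, A3, G3, eval_mul, eval_pow, SP_eval, eval_C]
  rw [show n+2-1 = n+1 by omega, show l+1-1 = l by omega,
    show j+1-1 = j by omega, show n+2-2 = n by omega]
  push_cast
  ring

lemma fin_int (m j n l : ℕ) (s1 s2 s3 : ℝ) (f : ℝ × ℝ → ℝ)
    (hf : ∀ p, f p = s1 * (alphaTri1 (n+2) (l+1) * dot2 (vtTriI (m+2) (j+1) p) (Btri (n+2) (l+1) p))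
      + s2 * dot2 (vtTriI (m+2) (j+1) p) (Ctri (n+2) (l+1) p)
      + s3 * (alphaTri2 (n+2) (l+1) * dot2 (vtTriII (m+2) (j+1) p) (Ctri (n+2) (l+1) p))) :
    ∫ p in Tri, f p = (s1 + s3) * if (m+2, j+1) = (n+2, l+1) then 1 else 0 := by
  have : ∫ p in Tri, f p = ∫ p in Tri, 
      (((s1 * alphaTri1 (n+2) (l+1)) * ((A1 m n).eval (2*p.1/(1-p.2)) * (G1 m j n l).eval p.2)
      + s2 * ((A2 m n).eval (2*p.1/(1-p.2)) * (G2 m j n l).eval p.2))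
      + (s3 * alphaTri2 (n+2) (l+1)) * ((A3 m n).eval (2*p.1/(1-p.2)) * (G3 m j n l).eval p.2)) := by
    apply setIntegral_congr_fun tri_open.measurableSet
    intro p hp
    simp only
    rw [hf, pt1 _ _ _ _ p hp, pt2 _ _ _ _ p hp, pt3 _ _ _ _ p hp]
    ring
  rw [this]
  have i1 := (tri_int1 (A1 m n) (G1 m j n l)).const_mul (s1 * alphaTri1 (n+2) (l+1))
  have i2 := (tri_int1 (A2 m n) (G2 m j n l)).const_mul s2
  have i3 := (tri_int1 (A3 m n) (G3 m j n l)).const_mul (s3 * alphaTri2 (n+2) (l+1))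
  rw [integral_add (f := fun p : ℝ × ℝ => (s1 * alphaTri1 (n+2) (l+1)) * ((A1 m n).eval (2*p.1/(1-p.2)) * (G1 m j n l).eval p.2)
      + s2 * ((A2 m n).eval (2*p.1/(1-p.2)) * (G2 m j n l).eval p.2)) (i1.add i2) i3, integral_add i1 i2, integral_const_mul, integral_const_mul,
    integral_const_mul, tri_int2, tri_int2, tri_int2, V2, mul_assoc s1, mul_assoc s3, V1, V3]
  ring

end Helpers

/-- Full biorthonormality of the `H(curl)` interior shape functions of types I
and II on the triangle and their dual functions. -/
theorem triangle_Hcurl_biorthonormal (i j k l : ℕ) (hi : 2 ≤ i) (hk : 2 ≤ k)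
    (hj : 1 ≤ j) (hl : 1 ≤ l) :
    (∫ p in Tri, dot2 (vTriI i j p) (bTriI k l p) = if (i, j) = (k, l) then 1 else 0) ∧
    (∫ p in Tri, dot2 (vTriI i j p) (bTriII k l p) = 0) ∧
    (∫ p in Tri, dot2 (vTriII i j p) (bTriI k l p) = 0) ∧
    (∫ p in Tri, dot2 (vTriII i j p) (bTriII k l p) = if (i, j) = (k, l) then 1 else 0) := by
  obtain ⟨m, rfl⟩ : ∃ m, i = m + 2 := ⟨i - 2, by omega⟩
  obtain ⟨n, rfl⟩ : ∃ n, k = n + 2 := ⟨k - 2, by omega⟩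
  obtain ⟨j, rfl⟩ : ∃ m, j = m + 1 := ⟨j - 1, by omega⟩
  obtain ⟨l, rfl⟩ : ∃ m, l = m + 1 := ⟨l - 1, by omega⟩
  have hB : ∀ p, (Btri (n+2) (l+1) p).2 = 0 := fun p => rfl
  have hv : ∀ p, (vtTriII (m+2) (j+1) p).1 = 0 := fun p => rfl
  refine ⟨?_, ?_, ?_, ?_⟩
  · rw [fin_int m j n l (1/2) (1/2 * alphaTri2 (n+2) (l+1)) (1/2)]
    · ring
    · intro p
      simp only [dot2, vTriI, bTriI, Prod.fst_add, Prod.snd_add, Prod.smul_fst, Prod.smul_snd, smul_eq_mul, hB, hv]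
      ring
  · rw [fin_int m j n l (1/2) (-1/2 * alphaTri2 (n+2) (l+1)) (-1/2)]
    · ring
    · intro p
      simp only [dot2, vTriI, bTriII, Prod.fst_add, Prod.snd_add, Prod.fst_sub, Prod.snd_sub, Prod.smul_fst, Prod.smul_snd, smul_eq_mul, hB, hv]
      ring
  · rw [fin_int m j n l (1/2) (1/2 * alphaTri2 (n+2) (l+1)) (-1/2)]
    · ring
    · intro p
      simp only [dot2, vTriII, bTriI, Prod.fst_add, Prod.snd_add, Prod.fst_sub, Prod.snd_sub, Prod.smul_fst, Prod.smul_snd, smul_eq_mul, hB, hv]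
      ring
  · rw [fin_int m j n l (1/2) (-1/2 * alphaTri2 (n+2) (l+1)) (1/2)]
    · ring
    · intro p
      simp only [dot2, vTriII, bTriII, Prod.fst_sub, Prod.snd_sub, Prod.smul_fst, Prod.smul_snd, smul_eq_mul, hB, hv]
      ring
end

section
/- Let l ≥ 2 and j, m ≥ 1 be integers. With Q^{l,m}_2(χ) = −(χ/2) P^{(2l−1,1)}_{m−1}(χ) + (m/(2l+m−1)) ((1−χ)/2) P^{(2l,0)}_{m−1}(χ), the following one-dimensional orthogonality relation holds: ∫_{−1}^{1} ((1−χ)/2)^{2l−1} [ P^{(2l,0)}_{j−1}(χ) Q^{l,m}_2(χ) + ( (χ/2) P^{(2l,0)}_{j−1}(χ) − (j/2) P̂_j^{2l}(χ) ) P^{(2l−1,1)}_{m−1}(χ) ] dχ = 0. -/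
open MeasureTheory

/-- The auxiliary polynomial `Q^{l,m}_2`. -/
noncomputable def Qtet2 (l m : ℕ) (x : ℝ) : ℝ :=
  -(x/2) * jacobiP (m-1) (2*l-1) 1 x +
    ((m:ℝ) / (2*(l:ℝ) + (m:ℝ) - 1)) * ((1 - x)/2) * jacobiP (m-1) (2*l) 0 x

open Polynomial in
theorem iterD_mul_lin (s : ℝ) (f : ℝ[X]) (n : ℕ) :
    derivative^[n+1] ((1 + C s * X) * f) =
      (1 + C s * X) * derivative^[n+1] f + ((n:ℝ[X])+1) * C s * derivative^[n] f := by
  induction n with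
  | zero => simp [derivative_mul]; ring
  | succ n ih =>
    rw [Function.iterate_succ_apply', ih]
    simp only [Function.iterate_succ_apply', derivative_add, derivative_mul, derivative_one,
      derivative_C, derivative_X, derivative_natCast]
    push_cast
    ring

open Polynomial in
theorem jac_polys (n b : ℕ) (c : ℝ) : ∃ A B : ℝ[X],
    (derivative^[n] (C c * ((1 - X)^(b+1+n) * (1+X)^n)) = (1-X)^(b+1) * A) ∧
    (derivative^[n] (C c * ((1 - X)^(b+n) * (1+X)^(n+1))) = (1-X)^b * (1+X) * B) ∧
    (derivative ((1-X)^(b+1) * A) = - ((n:ℝ[X])+(b:ℝ[X])+1) * ((1-X)^b * B)) ∧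
    (derivative ((1+X) * B) = ((n:ℝ[X])+1) * A) := by
  set f : ℝ[X] := C c * ((1 - X)^(b+1+n) * (1+X)^n) with hf
  set g : ℝ[X] := C c * ((1 - X)^(b+n) * (1+X)^(n+1)) with hg
  have hd : (1-X : ℝ[X])^(b+1) ∣ derivative^[n] f := by
    have := pow_sub_dvd_iterate_derivative_of_pow_dvd (p := f) (q := (1-X : ℝ[X]))
      (n := b+1+n) n ⟨C c * (1+X)^n, by rw [hf]; ring⟩
    simpa using this
  obtain ⟨A, hA⟩ := hd
  have hne : ((n:ℝ)+b+1) ≠ 0 := by positivity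
  have hu : (1 - X : ℝ[X]) ≠ 0 := fun h => by
    have := congrArg (eval 0) h
    simp at this
  obtain ⟨B, hB⟩ : ∃ B : ℝ[X], ((n:ℝ[X])+(b:ℝ[X])+1) * B = ((b:ℝ[X])+1) * A - (1-X) * derivative A := by
    refine ⟨C (((n:ℝ)+b+1)⁻¹) * (((b:ℝ[X])+1) * A - (1-X) * derivative A), ?_⟩
    have : ((n:ℝ[X])+(b:ℝ[X])+1) * C (((n:ℝ)+b+1)⁻¹) = 1 := by
      have h2 : ((n:ℝ[X])+(b:ℝ[X])+1) = C ((n:ℝ)+b+1) := by simp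
      rw [h2, ← C_mul, mul_inv_cancel₀ hne, C_1]
    rw [← mul_assoc, this, one_mul]
  have hneP : ((n:ℝ[X])+(b:ℝ[X])+1) ≠ 0 := by
    have h2 : ((n:ℝ[X])+(b:ℝ[X])+1) = C ((n:ℝ)+b+1) := by simp
    rw [h2]; exact C_ne_zero.mpr hne
  have hDA : derivative ((1-X)^(b+1) * A) = - ((n:ℝ[X])+(b:ℝ[X])+1) * ((1-X)^b * B) := by
    have : - ((n:ℝ[X])+(b:ℝ[X])+1) * ((1-X)^b * B) = -(1-X)^b * (((n:ℝ[X])+(b:ℝ[X])+1) * B) := by ring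
    rw [this, hB]
    simp [derivative_mul, derivative_pow_succ]
    ring
  have e1 : derivative ((1 + C 1 * X) * f) = ((n:ℝ[X])+1) * f - ((n:ℝ[X])+(b:ℝ[X])+1) * g := by
    have : (1 + C 1 * X) * f = C c * ((1 - X)^(b+n+1) * (1+X)^(n+1)) := by
      rw [hf, C_1]; ring
    rw [this, hf, hg]
    simp [derivative_mul, derivative_pow_succ]
    ring
  have e2 : derivative ((1 + C (-1) * X) * g) = ((n:ℝ[X])+1) * f - ((n:ℝ[X])+(b:ℝ[X])+1) * g := by
    have : (1 + C (-1) * X) * g = (1 + C 1 * X) * f := by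
      rw [hf, hg]; simp; ring
    rw [this, e1]
  have hlin : ∀ p q r s : ℕ, derivative^[n] (((p:ℝ[X])+1) * f - ((r:ℝ[X])+(s:ℝ[X])+1) * g)
      = ((p:ℝ[X])+1) * derivative^[n] f - ((r:ℝ[X])+(s:ℝ[X])+1) * derivative^[n] g := by
    intro p q r s
    have h1 : ((p:ℝ[X])+1) = ((p+1:ℕ):ℝ[X]) := by simp
    have h2 : ((r:ℝ[X])+(s:ℝ[X])+1) = ((r+s+1:ℕ):ℝ[X]) := by simp
    rw [h1, h2, iterate_derivative_sub, iterate_derivative_natCast_mul,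
      iterate_derivative_natCast_mul]
  have i1 := iterD_mul_lin 1 f n
  have i2 := iterD_mul_lin (-1) g n
  rw [Function.iterate_succ_apply, e1, hlin _ 0, Function.iterate_succ_apply', hA, hDA] at i1
  rw [Function.iterate_succ_apply, e2, hlin _ 0, Function.iterate_succ_apply', hA] at i2
  have hG : derivative^[n] g = (1-X)^b * (1+X) * B := by
    apply mul_left_cancel₀ hneP
    simp only [C_1] at i1
    linear_combination -i1
  refine ⟨A, B, hA, hG, hDA, ?_⟩
  rw [hG] at i2
  apply mul_left_cancel₀ (pow_ne_zero (b+1) hu)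
  have h3 : (1-X) * derivative ((1-X)^b * (1+X) * B) =
      (1-X)^(b+1) * derivative ((1+X)*B) - (b:ℝ[X]) * (1-X)^b * ((1+X)*B) := by
    rw [mul_assoc, derivative_mul]
    cases b with
    | zero => simp
    | succ b => simp [derivative_pow_succ]; ring
  simp only [C_neg, C_1] at i2
  linear_combination -i2 - h3

open Polynomial in
theorem iteratedDeriv_poly (p : ℝ[X]) (n : ℕ) (x : ℝ) :
    iteratedDeriv n (fun t => p.eval t) x = (derivative^[n] p).eval x := by
  induction n generalizing x with
  | zero => simp
  | succ n ih =>
    rw [iteratedDeriv_succ, funext ih, Function.iterate_succ_apply', Polynomial.deriv]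

open Polynomial in
theorem jac_eval (n b : ℕ) : ∃ A B : ℝ[X],
    (∀ x : ℝ, -1 < x → x < 1 → jacobiP n (b+1) 0 x = A.eval x) ∧
    (∀ x : ℝ, -1 < x → x < 1 → jacobiP n b 1 x = B.eval x) ∧
    (∀ x : ℝ, HasDerivAt (fun x => (1-x)^(b+1) * A.eval x)
      (-((n:ℝ)+b+1) * ((1-x)^b * B.eval x)) x) ∧
    (∀ x : ℝ, HasDerivAt (fun x => (1+x) * B.eval x) (((n:ℝ)+1) * A.eval x) x) := by
  obtain ⟨A, B, hA, hB, h1, h2⟩ := jac_polys n b ((-1)^n / (2^n * (Nat.factorial n : ℝ)))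
  have hfac : (Nat.factorial n : ℝ) ≠ 0 := by positivity
  have key : ∀ p : ℝ[X], derivative^[n] p = C (2^n * (Nat.factorial n : ℝ)) *
      derivative^[n] (C ((2^n * (Nat.factorial n : ℝ))⁻¹) * p) := by
    intro p
    rw [iterate_derivative_C_mul, ← mul_assoc, ← C_mul, mul_inv_cancel₀ (by positivity)]
    simp
  refine ⟨A, B, ?_, ?_, ?_, ?_⟩
  · intro x hx hx'
    have hu : (1 - x) ≠ 0 := by linarith
    have hfun : (fun t : ℝ => (1 - t)^(b+1) * (1 + t)^0 * (t^2 - 1)^n) =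
        fun t => ((1-X)^(b+1) * (1+X)^0 * (X^2-1)^n : ℝ[X]).eval t := by
      funext t; simp
    have e : (C ((2^n * (Nat.factorial n : ℝ))⁻¹) * ((1-X)^(b+1) * (1+X)^0 * (X^2-1)^n) : ℝ[X]) =
        C ((-1)^n / (2^n * (Nat.factorial n : ℝ))) * ((1 - X)^(b+1+n) * (1+X)^n) := by
      have : (X^2-1 : ℝ[X]) = C (-1) * ((1-X) * (1+X)) := by simp; ring
      rw [this, div_eq_mul_inv, C_mul, mul_pow, mul_pow, C_pow]; ring
    unfold jacobiP
    rw [hfun, iteratedDeriv_poly, key, e, hA]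
    simp
    field_simp
  · intro x hx hx'
    have hu : (1 - x) ≠ 0 := by linarith
    have hv : (1 + x) ≠ 0 := by linarith
    have hfun : (fun t : ℝ => (1 - t)^b * (1 + t)^1 * (t^2 - 1)^n) =
        fun t => ((1-X)^b * (1+X)^1 * (X^2-1)^n : ℝ[X]).eval t := by
      funext t; simp
    have e : (C ((2^n * (Nat.factorial n : ℝ))⁻¹) * ((1-X)^b * (1+X)^1 * (X^2-1)^n) : ℝ[X]) =
        C ((-1)^n / (2^n * (Nat.factorial n : ℝ))) * ((1 - X)^(b+n) * (1+X)^(n+1)) := by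
      have : (X^2-1 : ℝ[X]) = C (-1) * ((1-X) * (1+X)) := by simp; ring
      rw [this, div_eq_mul_inv, C_mul, mul_pow, mul_pow, C_pow]; ring
    unfold jacobiP
    rw [hfun, iteratedDeriv_poly, key, e, hB]
    simp
    field_simp
  · intro x
    have := ((1-X)^(b+1) * A : ℝ[X]).hasDerivAt x
    rw [h1] at this
    simpa using this
  · intro x
    have := ((1+X) * B : ℝ[X]).hasDerivAt x
    rw [h2] at this
    simpa using this

open Polynomial in
theorem parts_aux (b n k : ℕ) (A B A' B' : ℝ[X])
    (h1 : ∀ x : ℝ, HasDerivAt (fun x => (1-x)^(b+1) * A.eval x)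
      (-((n:ℝ)+b+1) * ((1-x)^b * B.eval x)) x)
    (h2 : ∀ x : ℝ, HasDerivAt (fun x => (1+x) * B'.eval x) (((k:ℝ)+1) * A'.eval x) x) :
    ((n:ℝ)+b+1) * (∫ x in (-1:ℝ)..1, (1-x)^b * (1+x) * (B.eval x * B'.eval x)) =
    ((k:ℝ)+1) * ∫ x in (-1:ℝ)..1, (1-x)^(b+1) * (A.eval x * A'.eval x) := by
  have h := intervalIntegral.integral_eq_sub_of_hasDerivAt (a := (-1:ℝ)) (b := 1)
    (fun x _ => (h1 x).mul (h2 x)) (Continuous.intervalIntegrable (by fun_prop) _ _)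
  simp only [Pi.mul_apply] at h
  norm_num at h
  rw [← sub_eq_zero, ← intervalIntegral.integral_const_mul, ← intervalIntegral.integral_const_mul,
    ← intervalIntegral.integral_sub (Continuous.intervalIntegrable (by fun_prop) _ _)
      (Continuous.intervalIntegrable (by fun_prop) _ _), ← neg_eq_zero,
    ← intervalIntegral.integral_neg, ← h]
  congr 1
  funext x
  ring

theorem main_aux (b n k : ℕ) :
    ∫ x in (-1:ℝ)..1, ((1 - x)/2)^b *
      (jacobiP k (b+1) 0 x * (-(x/2) * jacobiP n b 1 x +
    (((n:ℝ)+1) / ((n:ℝ)+b+1)) * ((1 - x)/2) * jacobiP n (b+1) 0 x) +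
        ((x/2) * jacobiP k (b+1) 0 x - (((k:ℝ)+1)/2) * (∫ t in (-1:ℝ)..x, jacobiP k (b+1) 0 t)) *
          jacobiP n b 1 x) = 0 := by
  obtain ⟨A, B, hA, hB, h1, h2⟩ := jac_eval n b
  obtain ⟨A', B', hA', hB', h1', h2'⟩ := jac_eval k b
  have p1 := parts_aux b n k A B A' B' h1 h2'
  have p2 := parts_aux b k n A' B' A B h1' h2
  simp only [mul_comm (Polynomial.eval _ A') (Polynomial.eval _ A),
    mul_comm (Polynomial.eval _ B') (Polynomial.eval _ B)] at p2
  have hI : ∀ x : ℝ, -1 < x → x < 1 →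
      ((k:ℝ)+1) * (∫ t in (-1:ℝ)..x, jacobiP k (b+1) 0 t) = (1+x) * B'.eval x := by
    intro x hx hx'
    have h := intervalIntegral.integral_eq_sub_of_hasDerivAt (a := (-1:ℝ)) (b := x)
      (fun x _ => h2' x) (Continuous.intervalIntegrable (by fun_prop) _ _)
    rw [intervalIntegral.integral_const_mul] at h
    norm_num at h
    rw [← h]
    congr 1
    apply intervalIntegral.integral_congr_ae
    refine Filter.Eventually.of_forall fun t ht => ?_
    rw [Set.uIoc_of_le hx.le] at ht
    exact hA' t ht.1 (ht.2.trans_lt hx')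
  have hc : ∫ x in (-1:ℝ)..1, ((1 - x)/2)^b *
      (jacobiP k (b+1) 0 x * (-(x/2) * jacobiP n b 1 x +
    (((n:ℝ)+1) / ((n:ℝ)+b+1)) * ((1 - x)/2) * jacobiP n (b+1) 0 x) +
        ((x/2) * jacobiP k (b+1) 0 x - (((k:ℝ)+1)/2) * (∫ t in (-1:ℝ)..x, jacobiP k (b+1) 0 t)) *
          jacobiP n b 1 x) =
      ∫ x in (-1:ℝ)..1, (((1/2)^(b+1) * (((n:ℝ)+1) / ((n:ℝ)+b+1))) *
          ((1-x)^(b+1) * (A.eval x * A'.eval x)) -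
        (1/2)^(b+1) * ((1-x)^b * (1+x) * (B.eval x * B'.eval x))) := by
    apply intervalIntegral.integral_congr_ae
    have hne : ∀ᵐ x : ℝ, x ≠ 1 := by
      simp [MeasureTheory.ae_iff, Real.volume_singleton]
    filter_upwards [hne] with x hx1 hx
    rw [Set.uIoc_of_le (by norm_num)] at hx
    have hx2 : x < 1 := lt_of_le_of_ne hx.2 hx1
    rw [hA x hx.1 hx2, hB x hx.1 hx2, hA' x hx.1 hx2, div_mul_eq_mul_div ((k:ℝ)+1), hI x hx.1 hx2,
      div_pow, div_pow, one_pow]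
    field_simp
    ring
  rw [hc, intervalIntegral.integral_sub (Continuous.intervalIntegrable (by fun_prop) _ _)
      (Continuous.intervalIntegrable (by fun_prop) _ _), intervalIntegral.integral_const_mul,
      intervalIntegral.integral_const_mul]
  set S := ∫ x in (-1:ℝ)..1, (1-x)^b * (1+x) * (B.eval x * B'.eval x)
  set T := ∫ x in (-1:ℝ)..1, (1-x)^(b+1) * (A.eval x * A'.eval x)
  have hn : ((n:ℝ)+b+1) ≠ 0 := by positivity
  have hS : ((n:ℝ)+b+1) * S = ((n:ℝ)+1) * T := by
    have h : ((n:ℝ)-k) * (((n:ℝ)+k+b+2) * T) = 0 := by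
      linear_combination ((n:ℝ)+b+1) * -p2 + ((k:ℝ)+b+1) * p1
    have hpos : ((n:ℝ)+k+b+2) ≠ 0 := by positivity
    rcases mul_eq_zero.mp h with h | h
    · linear_combination p1 - h * T
    · have hT : T = 0 := (mul_eq_zero.mp h).resolve_left hpos
      rw [p1, hT]; ring
  have : S = ((n:ℝ)+1) / ((n:ℝ)+b+1) * T := by
    field_simp
    linear_combination hS
  rw [this]; ring

/-- The one-dimensional orthogonality relation behind the construction of the
second component of `b̃^III` on the tetrahedron. -/
theorem tetrahedron_Q2_orthogonality (l j m : ℕ) (hl : 2 ≤ l) (hj : 1 ≤ j)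
    (hm : 1 ≤ m) :
    ∫ x in (-1:ℝ)..1, ((1 - x)/2)^(2*l-1) *
      (jacobiP (j-1) (2*l) 0 x * Qtet2 l m x +
        ((x/2) * jacobiP (j-1) (2*l) 0 x - ((j:ℝ)/2) * intJacobiP j (2*l) x) *
          jacobiP (m-1) (2*l-1) 1 x) = 0 := by
  obtain ⟨b, rfl⟩ : ∃ b, m = b + 1 := ⟨m - 1, by omega⟩
  obtain ⟨k, rfl⟩ : ∃ k, j = k + 1 := ⟨j - 1, by omega⟩
  obtain ⟨d, hd⟩ : ∃ d, 2 * l = d + 1 := ⟨2 * l - 1, by omega⟩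
  have h := main_aux d b k
  have hd' : (2:ℝ) * l = d + 1 := by exact_mod_cast hd
  unfold Qtet2 intJacobiP
  rw [hd, hd']
  simp only [Nat.add_sub_cancel]
  push_cast
  have e : (d:ℝ) + 1 + (b + 1) - 1 = b + d + 1 := by ring
  rw [e]
  exact h
end
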